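/- For a general source X, 0 ≤ ε < 1, and a > 0, the infimum L(ε,a|X) of (ε,a)-achievable second-order overflow thresholds (L such that there exist prefix-free encoders φ_n with limsup_n Pr[c(φ_n(X^n)) > na + L√n] ≤ ε) equals inf{ L : F_a(L) ≤ ε }, where F_a(L) = limsup_{n→∞} Pr[ (−log_K P_{X^n}(X^n) − n α_c a)/(√n α_c) ≥ L ]. -/

import Mathlib

/-- Additive cost of a string over the code alphabet. -/
noncomputable def strCost {U : Type*} (c : U → ℝ) (s : List U) : ℝ := (s.map c).sum

/-- Probability of a set under a (real-valued) distribution. -/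
noncomputable def prob {X : Type*} (P : X → ℝ) (S : Set X) : ℝ := ∑' x, S.indicator P x

@[simp] theorem strCost_nil {U : Type*} (c : U → ℝ) : strCost c [] = 0 := by simp [strCost]

@[simp] theorem strCost_cons {U : Type*} (c : U → ℝ) (u : U) (s : List U) :
    strCost c (u :: s) = c u + strCost c s := by simp [strCost]

/-- A set of strings none of which is a proper prefix of another. -/
def PrefixFree {U : Type*} (A : Set (List U)) : Prop :=
  ∀ s ∈ A, ∀ t ∈ A, s <+: t → s = t

theorem pairwiseDisjoint_image_cons {U : Type*} [DecidableEq U] (s : Set U)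
    (B : U → Finset (List U)) : s.PairwiseDisjoint fun u => (B u).image (List.cons u) := by
  intro u _ v _ huv
  rw [Function.onFun, Finset.disjoint_left]
  simp only [Finset.mem_image]
  rintro _ ⟨s, _, rfl⟩ ⟨t, _, h⟩
  exact huv (List.cons.inj h).1.symm

/-- The generalized Kraft inequality for a finite prefix-free code. -/
theorem PrefixFree.kraft {U : Type*} [Fintype U] {c : U → ℝ} {α b : ℝ} (hb : 0 < b)
    (hroot : ∑ u : U, b ^ (-(α * c u)) ≤ 1) {A : Finset (List U)}
    (hA : PrefixFree (A : Set (List U))) :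
    ∑ s ∈ A, b ^ (-(α * strCost c s)) ≤ 1 := by
  classical
  suffices H : ∀ N : ℕ, ∀ A : Finset (List U), PrefixFree (A : Set (List U)) →
      (∀ s ∈ A, s.length ≤ N) → ∑ s ∈ A, b ^ (-(α * strCost c s)) ≤ 1 from
    H (A.sup List.length) A hA fun s hs => Finset.le_sup (f := List.length) hs
  intro N
  induction N with
  | zero =>
    intro A _ hlen
    have hsub : A ⊆ {[]} := fun s hs => by simpa using hlen s hs
    calc ∑ s ∈ A, b ^ (-(α * strCost c s))
        ≤ ∑ s ∈ ({[]} : Finset (List U)), b ^ (-(α * strCost c s)) :=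
          Finset.sum_le_sum_of_subset_of_nonneg hsub fun _ _ _ => by positivity
      _ ≤ 1 := by simp
  | succ N ih =>
    intro A hA hlen
    by_cases hnil : [] ∈ A
    · have hsub : A ⊆ {[]} := fun s hs => by
        simpa using (hA [] hnil s hs List.nil_prefix).symm
      calc ∑ s ∈ A, b ^ (-(α * strCost c s))
          ≤ ∑ s ∈ ({[]} : Finset (List U)), b ^ (-(α * strCost c s)) :=
            Finset.sum_le_sum_of_subset_of_nonneg hsub fun _ _ _ => by positivity
        _ ≤ 1 := by simp
    · let B : U → Finset (List U) := fun u =>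
        A.preimage (List.cons u) (List.cons_injective.injOn)
      have hB : ∀ u, ∑ s ∈ B u, b ^ (-(α * strCost c s)) ≤ 1 := fun u => by
        refine ih (B u) (fun s hs t ht hst => ?_) fun s hs => ?_
        · have := hA (u :: s) (by simpa [B] using hs) (u :: t) (by simpa [B] using ht)
            (by simpa [List.cons_prefix_cons] using hst)
          simpa using this
        · simpa using hlen (u :: s) (by simpa [B] using hs)
      have hdecomp : A = Finset.univ.biUnion fun u => (B u).image (List.cons u) := by
        ext s
        cases s with
        | nil => simp [hnil]
        | cons v s => simp [B]
      have hle : ∑ s ∈ A, b ^ (-(α * strCost c s)) ≤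
          ∑ u : U, ∑ s ∈ (B u).image (List.cons u), b ^ (-(α * strCost c s)) := by
        conv_lhs => rw [hdecomp]
        rw [Finset.sum_biUnion (pairwiseDisjoint_image_cons _ _)]
      refine hle.trans (le_trans (Finset.sum_le_sum fun u _ => ?_) hroot)
      rw [Finset.sum_image (List.cons_injective.injOn)]
      calc ∑ s ∈ B u, b ^ (-(α * strCost c (u :: s)))
          = b ^ (-(α * c u)) * ∑ s ∈ B u, b ^ (-(α * strCost c s)) := by
            rw [Finset.mul_sum]
            refine Finset.sum_congr rfl fun s _ => ?_
            rw [← Real.rpow_add hb, strCost_cons]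
            ring_nf
        _ ≤ b ^ (-(α * c u)) := mul_le_of_le_one_right (by positivity) (hB u)

/-- Below cost `T + M`, with `M` a bound on the symbol costs, there are prefix-free codes with at
least `b ^ (α * T)` codewords. -/
theorem exists_prefixFree_card_ge {U : Type*} [Fintype U] [Nonempty U] {c : U → ℝ}
    (hc : ∀ u, 0 < c u) {α b : ℝ} (hα : 0 < α) (hb : 1 < b)
    (hroot : ∑ u : U, b ^ (-(α * c u)) = 1) {M : ℝ} (hM : ∀ u, c u ≤ M) (T : ℝ) :
    ∃ A : Finset (List U), PrefixFree (A : Set (List U)) ∧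
      (∀ s ∈ A, strCost c s ≤ max 0 (T + M)) ∧ b ^ (α * T) ≤ A.card := by
  classical
  obtain ⟨u₀, hu₀⟩ := Finite.exists_min c
  suffices H : ∀ k : ℕ, ∀ T : ℝ, T ≤ k * c u₀ → ∃ A : Finset (List U),
      PrefixFree (A : Set (List U)) ∧
      (∀ s ∈ A, strCost c s ≤ max 0 (T + M)) ∧ b ^ (α * T) ≤ A.card by
    obtain ⟨k, hk⟩ := exists_nat_ge (T / c u₀)
    exact H k T ((div_le_iff₀ (hc u₀)).1 hk)
  have hbase : ∀ T : ℝ, T ≤ 0 → ∃ A : Finset (List U), PrefixFree (A : Set (List U)) ∧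
      (∀ s ∈ A, strCost c s ≤ max 0 (T + M)) ∧ b ^ (α * T) ≤ A.card := fun T hT => by
    refine ⟨{[]}, ?_, ?_, ?_⟩
    · intro s hs t ht _
      simp_all
    · simp
    · simpa using Real.rpow_le_one_of_one_le_of_nonpos hb.le
        (mul_nonpos_of_nonneg_of_nonpos hα.le hT)
  intro k
  induction k with
  | zero => exact fun T hT => hbase T (by simpa using hT)
  | succ k ih =>
    intro T hT
    rcases le_or_gt T 0 with hT0 | hT0
    · exact hbase T hT0
    push_cast at hT
    have hstep : ∀ u, T - c u ≤ k * c u₀ := fun u => by linarith [hu₀ u]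
    choose A hpf hcost hcard using fun u => ih (T - c u) (hstep u)
    refine ⟨Finset.univ.biUnion fun u => (A u).image (List.cons u), ?_, ?_, ?_⟩
    · intro s hs t ht hst
      simp only [Finset.coe_biUnion, Finset.mem_coe, Finset.mem_univ, Set.iUnion_true,
        Set.mem_iUnion, Finset.mem_image] at hs ht
      obtain ⟨u, s', hs', rfl⟩ := hs
      obtain ⟨v, t', ht', rfl⟩ := ht
      obtain ⟨rfl, h⟩ := List.cons_prefix_cons.1 hst
      rw [hpf u s' hs' t' ht' h]
    · intro s hs
      simp only [Finset.mem_biUnion, Finset.mem_univ, true_and, Finset.mem_image] at hs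
      obtain ⟨u, s', hs', rfl⟩ := hs
      have h1 := hcost u s' hs'
      have h2 := hM u
      rw [strCost_cons]
      refine le_max_of_le_right ?_
      rcases le_max_iff.1 h1 with h | h <;> linarith
    · rw [Finset.card_biUnion (pairwiseDisjoint_image_cons _ _)]
      simp only [Finset.card_image_of_injective _ List.cons_injective]
      push_cast
      calc b ^ (α * T) = ∑ u, b ^ (α * (T - c u)) := by
            rw [← mul_one (b ^ (α * T)), ← hroot, Finset.mul_sum]
            refine Finset.sum_congr rfl fun u _ => ?_
            rw [← Real.rpow_add (by linarith)]
            ring_nf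
        _ ≤ ∑ u, ((A u).card : ℝ) := Finset.sum_le_sum fun u _ => hcard u

theorem replicate_append_singleton_prefix {U : Type*} {u v : U} (huv : u ≠ v) {j k : ℕ}
    (h : List.replicate j u ++ [v] <+: List.replicate k u ++ [v]) : j = k := by
  induction j generalizing k with
  | zero =>
    cases k with
    | zero => rfl
    | succ k =>
      simp only [List.replicate_zero, List.nil_append, List.replicate_succ, List.cons_append,
        List.cons_prefix_cons] at h
      exact absurd h.1.symm huv
  | succ j ih =>
    cases k with
    | zero =>
      simp only [List.replicate_zero, List.nil_append, List.replicate_succ, List.cons_append,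
        List.cons_prefix_cons] at h
      exact absurd h.1 huv
    | succ k =>
      simp only [List.replicate_succ, List.cons_append, List.cons_prefix_cons, true_and] at h
      rw [ih h]

/-- A countable alphabet has a prefix-free encoder which sends a given small set of letters to the
codewords of a given prefix-free code, up to one leading symbol. -/
theorem exists_prefix_encoder {U X : Type*} [Countable X] {u v : U} (huv : u ≠ v)
    {A : Finset (List U)} (hA : PrefixFree (A : Set (List U))) {G : Set X} (hG : G.Finite)
    (hcard : G.ncard ≤ A.card) :
    ∃ φ : X → List U, Function.Injective φ ∧ (∀ x, φ x ≠ []) ∧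
      (∀ x y, φ x <+: φ y → φ x = φ y) ∧ ∀ x ∈ G, ∃ s ∈ A, φ x = u :: s := by
  classical
  obtain ⟨e, he⟩ := exists_injective_nat X
  obtain ⟨g, hgA, hg⟩ := hG.exists_injOn_of_encard_le (t := (A : Set (List U))) (by
    rw [← hG.cast_ncard_eq, Set.encard_coe_eq_coe_finsetCard]
    exact_mod_cast hcard)
  let φ : X → List U := fun x =>
    if x ∈ G then u :: g x else v :: (List.replicate (e x) u ++ [v])
  have key : ∀ x y, φ x <+: φ y → x = y := by
    intro x y h
    by_cases hx : x ∈ G <;> by_cases hy : y ∈ G <;>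
      simp only [φ, hx, hy, if_true, if_false, List.cons_prefix_cons] at h
    · exact hg hx hy (hA _ (hgA hx) _ (hgA hy) h.2)
    · exact absurd h.1 huv
    · exact absurd h.1.symm huv
    · exact he (replicate_append_singleton_prefix huv h.2)
  refine ⟨φ, fun x y h => key x y (by rw [h]), fun x => ?_, fun x y h => by rw [key x y h],
    fun x hx => ⟨g x, hgA hx, by simp [φ, hx]⟩⟩
  by_cases hx : x ∈ G <;> simp [φ, hx]

section prob

variable {X : Type*} {P : X → ℝ}

theorem prob_le_of_indicator_le (hP : Summable P) {S T : Set X}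
    {r : X → ℝ} (hr : Summable r)
    (h : ∀ x, S.indicator P x ≤ T.indicator P x + r x) :
    prob P S ≤ prob P T + ∑' x, r x := by
  rw [prob, prob, ← (hP.indicator T).tsum_add hr]
  exact (hP.indicator S).tsum_le_tsum h ((hP.indicator T).add hr)

theorem prob_nonneg (hP0 : ∀ x, 0 ≤ P x) (S : Set X) : 0 ≤ prob P S :=
  tsum_nonneg fun x => Set.indicator_nonneg (fun x _ => hP0 x) x

theorem prob_le_one (hP0 : ∀ x, 0 ≤ P x) (hP : HasSum P 1) (S : Set X) : prob P S ≤ 1 := by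
  rw [← hP.tsum_eq]
  exact (hP.summable.indicator S).tsum_le_tsum
    (fun x => Set.indicator_le_self' (fun x _ => hP0 x) x) hP.summable

/-- At most `t⁻¹` letters have probability above `t`. -/
theorem finite_and_ncard_le_of_lt (hP0 : ∀ x, 0 ≤ P x) (hP : HasSum P 1) {t : ℝ} (ht : 0 < t) :
    {x | t < P x}.Finite ∧ ({x | t < P x}.ncard : ℝ) ≤ t⁻¹ := by
  have hfin : {x | t < P x}.Finite := by
    have h := hP.summable.tendsto_cofinite_zero.eventually_lt_const ht
    rw [Filter.eventually_cofinite] at h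
    exact h.subset fun x hx => not_lt.2 (le_of_lt hx)
  refine ⟨hfin, ?_⟩
  rw [Set.ncard_eq_toFinset_card _ hfin, ← one_div, le_div_iff₀ ht]
  calc (hfin.toFinset.card : ℝ) * t = ∑ _x ∈ hfin.toFinset, t := by simp
    _ ≤ ∑ x ∈ hfin.toFinset, P x :=
        Finset.sum_le_sum fun x hx => le_of_lt (by simpa using hx)
    _ ≤ 1 := sum_le_hasSum _ (fun x _ => hP0 x) hP

end prob

theorem limsup_le_of_eventually_le_add {f g δ : ℕ → ℝ} {ε : ℝ} (hf : ∀ n, 0 ≤ f n)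
    (hg : ∀ n, g n ≤ 1) (hδ : Filter.Tendsto δ Filter.atTop (nhds 0))
    (hfg : ∀ᶠ n in Filter.atTop, f n ≤ g n + δ n)
    (h : Filter.limsup g Filter.atTop ≤ ε) : Filter.limsup f Filter.atTop ≤ ε := by
  refine le_of_forall_pos_le_add fun η hη => ?_
  have h1 : ∀ᶠ n in Filter.atTop, g n < ε + η / 2 :=
    Filter.eventually_lt_of_limsup_lt (by linarith)
      (Filter.isBoundedUnder_of ⟨1, hg⟩)
  have h2 : ∀ᶠ n in Filter.atTop, δ n < η / 2 := hδ.eventually_lt_const (by linarith)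
  refine Filter.limsup_le_of_le
    (Filter.isBoundedUnder_of ⟨0, hf⟩ : Filter.IsBoundedUnder (· ≥ ·) _ f).isCoboundedUnder_le ?_
  filter_upwards [h1, h2, hfg] with n a1 a2 a3
  linarith

theorem sInf_eq_of_forall_pos_add_mem {S T : Set ℝ}
    (hST : ∀ L ∈ S, ∀ γ > 0, L + γ ∈ T) (hTS : ∀ L ∈ T, ∀ γ > 0, L + γ ∈ S) :
    sInf S = sInf T := by
  have bdd : ∀ {A B : Set ℝ}, (∀ L ∈ A, ∀ γ > 0, L + γ ∈ B) → BddBelow B → BddBelow A := by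
    rintro A B hAB ⟨m, hm⟩
    exact ⟨m - 1, fun L hL => by linarith [hm (hAB L hL 1 one_pos)]⟩
  have le : ∀ {A B : Set ℝ}, (∀ L ∈ A, ∀ γ > 0, L + γ ∈ B) → A.Nonempty → BddBelow B →
      sInf B ≤ sInf A := by
    intro A B hAB hA hB
    refine le_csInf hA fun L hL => le_of_forall_pos_le_add fun γ hγ => ?_
    exact csInf_le hB (hAB L hL γ hγ)
  rcases S.eq_empty_or_nonempty with rfl | hS
  · rcases T.eq_empty_or_nonempty with rfl | ⟨L, hL⟩
    · rfl
    · exact absurd (hTS L hL 1 one_pos) (Set.notMem_empty _)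
  have hT : T.Nonempty := hS.elim fun L hL => ⟨_, hST L hL 1 one_pos⟩
  by_cases hb : BddBelow S
  · exact le_antisymm (le hTS hT hb) (le hST hS (bdd hTS hb))
  · rw [Real.sInf_of_not_bddBelow hb, Real.sInf_of_not_bddBelow fun h => hb (bdd hST h)]

/-- Any prefix-free encoder overflows a cost threshold at least as often, up to an exponentially
small term, as the self-information overflows a slightly larger one. -/
theorem prob_le_prob_overflow_add {U X : Type*} [Fintype U] {c : U → ℝ} {α b : ℝ}
    (hb : 0 < b) (hroot : ∑ u : U, b ^ (-(α * c u)) ≤ 1) {P : X → ℝ} (hP0 : ∀ x, 0 ≤ P x)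
    (hP : Summable P) {φ : X → List U} (hinj : Function.Injective φ)
    (hpf : ∀ x y, φ x <+: φ y → φ x = φ y) {S : Set X} {T d : ℝ} (hα : 0 ≤ α) (hb1 : 1 ≤ b)
    (hS : ∀ x ∈ S, 0 < P x → P x ≤ b ^ (-(α * (T + d)))) :
    prob P S ≤ prob P {x | T < strCost c (φ x)} + b ^ (-(α * d)) := by
  classical
  have hfin : ∀ F : Finset X, ∑ x ∈ F, b ^ (-(α * strCost c (φ x))) ≤ 1 := fun F => by
    rw [← Finset.sum_image (f := fun s => b ^ (-(α * strCost c s))) (g := φ) hinj.injOn]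
    refine PrefixFree.kraft hb hroot ?_
    intro s hs t ht
    simp only [Finset.coe_image, Set.mem_image] at hs ht
    obtain ⟨x, _, rfl⟩ := hs
    obtain ⟨y, _, rfl⟩ := ht
    exact hpf x y
  have hsum : Summable fun x => b ^ (-(α * strCost c (φ x))) :=
    summable_of_sum_le (fun _ => by positivity) hfin
  have htsum : ∑' x, b ^ (-(α * strCost c (φ x))) ≤ 1 :=
    hsum.tsum_le_of_sum_le hfin
  refine (prob_le_of_indicator_le hP (hsum.mul_left (b ^ (-(α * d))))
    (T := {x | T < strCost c (φ x)}) fun x => ?_).trans ?_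
  · have hpos : 0 ≤ b ^ (-(α * d)) * b ^ (-(α * strCost c (φ x))) := by positivity
    by_cases hxS : x ∈ S
    · by_cases hxT : T < strCost c (φ x)
      · simpa [hxS, hxT] using hpos
      · simp only [Set.indicator, hxS, if_true, Set.mem_ofPred_eq, hxT, if_false, zero_add]
        rcases (hP0 x).eq_or_lt with h0 | h0
        · rw [← h0]
          exact hpos
        refine (hS x hxS h0).trans ?_
        rw [← Real.rpow_add hb]
        refine Real.rpow_le_rpow_of_exponent_le hb1 ?_
        have := mul_le_mul_of_nonneg_left (not_lt.1 hxT) hα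
        linarith
    · rw [Set.indicator_of_notMem hxS]
      exact add_nonneg (Set.indicator_nonneg (fun x _ => hP0 x) x) hpos
  · rw [tsum_mul_left]
    have : b ^ (-(α * d)) * ∑' x, b ^ (-(α * strCost c (φ x))) ≤ b ^ (-(α * d)) :=
      mul_le_of_le_one_right (by positivity) htsum
    linarith

/-- Some prefix-free encoder keeps the cost of all letters of probability above `b ^ (-(α * T))`
below `T` plus a constant. -/
theorem exists_encoder_strCost_le {U X : Type*} [Fintype U] [Nontrivial U] [Countable X]
    {c : U → ℝ} (hc : ∀ u, 0 < c u) {α b : ℝ} (hα : 0 < α) (hb : 1 < b)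
    (hroot : ∑ u : U, b ^ (-(α * c u)) = 1) {M : ℝ} (hM : ∀ u, c u ≤ M)
    {P : X → ℝ} (hP0 : ∀ x, 0 ≤ P x) (hP : HasSum P 1) (T : ℝ) :
    ∃ φ : X → List U, Function.Injective φ ∧ (∀ x, φ x ≠ []) ∧
      (∀ x y, φ x <+: φ y → φ x = φ y) ∧
      ∀ x, b ^ (-(α * T)) < P x → strCost c (φ x) ≤ T + 2 * M := by
  have hb0 : 0 < b := by linarith
  obtain ⟨u, v, huv⟩ := exists_pair_ne U
  obtain ⟨A, hA, hcost, hcard⟩ := exists_prefixFree_card_ge hc hα hb hroot hM T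
  obtain ⟨hG, hGcard⟩ := finite_and_ncard_le_of_lt hP0 hP
    (Real.rpow_pos_of_pos hb0 (-(α * T)))
  rw [Real.rpow_neg hb0.le, inv_inv] at hGcard
  obtain ⟨φ, h1, h2, h3, h4⟩ := exists_prefix_encoder huv hA hG
    (by rw [Real.rpow_neg hb0.le]; exact_mod_cast hGcard.trans hcard)
  refine ⟨φ, h1, h2, h3, fun x hx => ?_⟩
  obtain ⟨s, hs, hφ⟩ := h4 x hx
  have hT : 0 < T := by
    have hlt : b ^ (-(α * T)) < b ^ (0 : ℝ) := by
      rw [Real.rpow_zero]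
      exact hx.trans_le (le_hasSum hP x fun y _ => hP0 y)
    have := (Real.rpow_lt_rpow_left_iff hb).1 hlt
    exact (mul_pos_iff_of_pos_left hα).1 (by linarith)
  have hMu := hM u
  have hcu := hc u
  have := hcost s hs
  rw [max_eq_right (by linarith)] at this
  rw [hφ, strCost_cons]
  linarith

theorem le_logb_inv_sub_div_iff {b α p r m L : ℝ} (hb : 1 < b) (hα : 0 < α) (hp : 0 < p)
    (hr : 0 < r) :
    L ≤ (Real.logb b p⁻¹ - m * α) / (r * α) ↔ p ≤ b ^ (-(α * (m + L * r))) := by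
  rw [le_div_iff₀ (by positivity), ← Real.logb_le_iff_le_rpow hb hp, Real.logb_inv]
  constructor <;> intro h <;> linarith

/-- General formula for the infimum of (ε,a)-achievable second-order overflow
thresholds: `L(ε,a|X) = inf { L : F_a(L) ≤ ε }`. -/
theorem second_order_overflow_threshold {U : Type*} [Fintype U] (K : ℕ) (hK : 2 ≤ K)
    (hcard : Fintype.card U = K) (c : U → ℝ) (hc : ∀ u, 0 < c u)
    (α : ℝ) (hα : 0 < α) (hroot : ∑ u : U, (K : ℝ) ^ (-(α * c u)) = 1)
    (𝒳 : ℕ → Type) [∀ n, Countable (𝒳 n)]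
    (P : ∀ n, 𝒳 n → ℝ) (hP0 : ∀ n x, 0 ≤ P n x) (hP1 : ∀ n, HasSum (P n) 1)
    (ε : ℝ) (hε0 : 0 ≤ ε) (hε1 : ε < 1) (a : ℝ) (ha : 0 < a) :
    sInf {L : ℝ | ∃ φ : ∀ n, 𝒳 n → List U,
        (∀ n, Function.Injective (φ n)) ∧ (∀ n x, φ n x ≠ []) ∧
        (∀ n x y, φ n x <+: φ n y → φ n x = φ n y) ∧
        Filter.limsup
          (fun n => prob (P n)
            {x | (n : ℝ) * a + L * Real.sqrt n < strCost c (φ n x)})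
          Filter.atTop ≤ ε}
      = sInf {L : ℝ |
          Filter.limsup
            (fun n => prob (P n)
              {x | L ≤ (Real.logb K (P n x)⁻¹ - (n : ℝ) * α * a) / (Real.sqrt n * α)})
            Filter.atTop ≤ ε} := by
  have hb : (1 : ℝ) < K := by exact_mod_cast hK
  have hb0 : (0 : ℝ) < K := by linarith
  have : Nontrivial U := Fintype.one_lt_card_iff_nontrivial.1 (by omega)
  obtain ⟨M, hM⟩ : ∃ M, ∀ u, c u ≤ M :=
    (Finite.exists_max c).imp' c fun _ h => h
  have hassoc : ∀ n : ℕ, (n : ℝ) * α * a = n * a * α := fun n => by ring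
  have hsqrt : Filter.Tendsto (fun n : ℕ => Real.sqrt n) Filter.atTop Filter.atTop :=
    Real.tendsto_sqrt_atTop.comp tendsto_natCast_atTop_atTop
  simp only [hassoc]
  refine sInf_eq_of_forall_pos_add_mem ?_ ?_
  · rintro L ⟨φ, hinj, -, hpf, hlim⟩ γ hγ
    refine limsup_le_of_eventually_le_add (δ := fun n : ℕ => (K : ℝ) ^ (-(α * (γ * Real.sqrt n))))
      (fun n => prob_nonneg (hP0 n) _) (fun n => prob_le_one (hP0 n) (hP1 n) _) ?_ ?_ hlim
    · refine (tendsto_rpow_atBot_of_base_gt_one (K : ℝ) hb).comp ?_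
      exact Filter.tendsto_neg_atTop_atBot.comp ((hsqrt.const_mul_atTop hγ).const_mul_atTop hα)
    · filter_upwards [Filter.eventually_gt_atTop 0] with n hn
      have hr : 0 < Real.sqrt n := Real.sqrt_pos.2 (by exact_mod_cast hn)
      refine prob_le_prob_overflow_add hb0 hroot.le (hP0 n) (hP1 n).summable (hinj n) (hpf n)
        hα.le hb.le fun x hx hpx => ?_
      refine ((le_logb_inv_sub_div_iff hb hα hpx hr).1 hx).trans_eq ?_
      ring_nf
  · intro L hlim γ hγ
    choose φ hinj hne hpf hcost using fun n => exists_encoder_strCost_le hc hα hb hroot hM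
      (hP0 n) (hP1 n) ((n : ℝ) * a + L * Real.sqrt n)
    refine ⟨φ, hinj, hne, hpf, limsup_le_of_eventually_le_add (δ := fun _ => 0)
      (fun n => prob_nonneg (hP0 n) _) (fun n => prob_le_one (hP0 n) (hP1 n) _)
      tendsto_const_nhds ?_ hlim⟩
    filter_upwards [Filter.eventually_gt_atTop 0,
      (hsqrt.const_mul_atTop hγ).eventually_ge_atTop (2 * M)] with n hn hMn
    have hr : 0 < Real.sqrt n := Real.sqrt_pos.2 (by exact_mod_cast hn)
    refine (prob_le_of_indicator_le (r := fun _ => 0) (hP1 n).summable summable_zero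
      fun x => ?_).trans_eq (by rw [tsum_zero])
    rw [add_zero]
    rcases (hP0 n x).eq_or_lt with h0 | h0
    · simp [Set.indicator, ← h0]
    simp only [Set.indicator, Set.mem_ofPred_eq, le_logb_inv_sub_div_iff hb hα h0 hr]
    split_ifs with h1 h2
    · exact le_rfl
    · have := hcost n x (not_le.1 h2)
      linarith
    · exact h0.le
    · exact le_rfl
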